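/- Let 1 ≤ p ≤ n−1 and let □̃_p = ∂*∂ + ∂∂* with dom(□̃_p) = {u ∈ dom(∂) ∩ dom(∂*) : ∂u ∈ dom(∂*) and ∂*u ∈ dom(∂)}, acting on A²_{(p,0)}(ℂⁿ, e^{-|z|²}). Then □̃_p : dom(□̃_p) → A²_{(p,0)}(ℂⁿ, e^{-|z|²}) is bijective and has a bounded inverse Ñ_p : A²_{(p,0)}(ℂⁿ, e^{-|z|²}) → dom(□̃_p); moreover ‖Ñ_p u‖ ≤ (1/p)‖u‖ for every u ∈ A²_{(p,0)}(ℂⁿ, e^{-|z|²}). -/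

import Mathlib

open MeasureTheory Filter Complex Finset

noncomputable section

/-- Points of `ℂⁿ`. -/
abbrev Cn (n : ℕ) := Fin n → ℂ

/-- A form with coefficients indexed by subsets of `{1,…,n}`; a `(p,0)`-form
`Σ'_{|J|=p} u_J dz_J` is such a family supported on sets of cardinality `p`. -/
abbrev FormC (n : ℕ) := Finset (Fin n) → Cn n → ℂ

/-- The Fock weight `e^{-|z|²}` on `ℂⁿ`. -/
def fWt {n : ℕ} (z : Cn n) : ℝ := Real.exp (-(∑ j, ‖z j‖ ^ 2))

/-- Squared Fock norm `‖f‖² = ∫ |f|² e^{-|z|²} dλ`. -/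
def fNormSq {n : ℕ} (f : Cn n → ℂ) : ℝ := ∫ z : Cn n, ‖f z‖ ^ 2 * fWt z

/-- Fock inner product `(f,g) = ∫ f ḡ e^{-|z|²} dλ`. -/
def fInner {n : ℕ} (f g : Cn n → ℂ) : ℂ :=
  ∫ z : Cn n, f z * (starRingEnd ℂ) (g z) * fWt z

/-- Membership in the Fock space `A²(ℂⁿ, e^{-|z|²})`. -/
def MemF {n : ℕ} (f : Cn n → ℂ) : Prop :=
  Differentiable ℂ f ∧ Integrable (fun z : Cn n => ‖f z‖ ^ 2 * fWt z)

/-- The holomorphic partial derivative `∂f/∂z_j`. -/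
def pdz {n : ℕ} (j : Fin n) (f : Cn n → ℂ) : Cn n → ℂ :=
  fun z => fderiv ℂ f z (Pi.single j 1)

/-- The sign `(-1)^{#{i ∈ J : i < j}}` arising from `dz_j ∧ dz_J`. -/
def sgn {n : ℕ} (j : Fin n) (J : Finset (Fin n)) : ℂ :=
  (-1 : ℂ) ^ (J.filter (fun i => i < j)).card

/-- The operator `∂`: `(∂u)_L = Σ_{j ∈ L} ± ∂u_{L\{j}}/∂z_j`, i.e.
`∂u = Σ'_J Σ_j (∂u_J/∂z_j) dz_j ∧ dz_J`. -/
def dOp {n : ℕ} (u : FormC n) : FormC n :=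
  fun L z => ∑ j ∈ L, sgn j (L.erase j) * pdz j (u (L.erase j)) z

/-- The adjoint `∂*`: `(∂*u)_K = Σ_{j ∉ K} ± z_j u_{K ∪ {j}}`, i.e.
`∂*u = Σ'_K Σ_j z_j u_{jK} dz_K` on the Fock space. -/
def dStarOp {n : ℕ} (u : FormC n) : FormC n :=
  fun K z => ∑ j ∈ Kᶜ, sgn j K * (z j * u (insert j K) z)

/-- The complex Laplacian `□̃ = ∂*∂ + ∂∂*`. -/
def boxOp {n : ℕ} (u : FormC n) : FormC n :=
  fun J z => dStarOp (dOp u) J z + dOp (dStarOp u) J z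

/-- All coefficients belong to the Fock space. -/
def MemA2 {n : ℕ} (u : FormC n) : Prop := ∀ J, MemF (u J)

/-- `u` is a `(p,0)`-form: only coefficients with `|J| = p` may be nonzero. -/
def IsDeg {n : ℕ} (p : ℕ) (u : FormC n) : Prop :=
  ∀ J : Finset (Fin n), J.card ≠ p → u J = 0

/-- Squared norm of a form: `Σ'_J ‖u_J‖²`. -/
def formNormSq {n : ℕ} (u : FormC n) : ℝ := ∑ J : Finset (Fin n), fNormSq (u J)

/-- Inner product of forms: `Σ'_J (u_J, v_J)`. -/
def formInner {n : ℕ} (u v : FormC n) : ℂ := ∑ J : Finset (Fin n), fInner (u J) (v J)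

/-- `u ∈ dom ∂`. -/
def domD {n : ℕ} (u : FormC n) : Prop := MemA2 u ∧ MemA2 (dOp u)

/-- `u ∈ dom ∂*`. -/
def domDs {n : ℕ} (u : FormC n) : Prop := MemA2 u ∧ MemA2 (dStarOp u)

/-- `u ∈ dom □̃`: `u ∈ dom ∂ ∩ dom ∂*`, `∂u ∈ dom ∂*` and `∂*u ∈ dom ∂`. -/
def domBox {n : ℕ} (u : FormC n) : Prop :=
  domD u ∧ domDs u ∧ domDs (dOp u) ∧ domD (dStarOp u)

/-! ### Entire functions of several variables -/

/-- Restricting an entire function to a complex line. -/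
theorem hasDerivAt_comp_line {n : ℕ} {f : Cn n → ℂ} (hf : Differentiable ℂ f) (z w : Cn n)
    (t : ℂ) : HasDerivAt (fun s : ℂ => f (z + s • w)) (fderiv ℂ f (z + t • w) w) t := by
  have h : HasDerivAt (fun s : ℂ => z + s • w) w t := by
    simpa using ((hasDerivAt_id t).smul_const w).const_add z
  exact (hf _).hasFDerivAt.comp_hasDerivAt t h

/-- Cauchy's estimate for the Fréchet derivative of an entire function. -/
theorem norm_fderiv_le_of_forall_closedBall {n : ℕ} {f : Cn n → ℂ} (hf : Differentiable ℂ f)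
    {z : Cn n} {M : ℝ} (hM : ∀ w ∈ Metric.closedBall z 1, ‖f w‖ ≤ M) :
    ‖fderiv ℂ f z‖ ≤ M := by
  have hM0 : 0 ≤ M := (norm_nonneg _).trans (hM z (by simp))
  refine ContinuousLinearMap.opNorm_le_of_unit_norm hM0 fun w hw => ?_
  have hd : Differentiable ℂ fun s : ℂ => f (z + s • w) := by fun_prop
  have := Complex.norm_deriv_le_of_forall_mem_sphere_norm_le (c := 0) (C := M) one_pos
    hd.diffContOnCl (fun t ht => hM _ (by
      simp only [mem_sphere_iff_norm, sub_zero] at ht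
      simp [norm_smul, ht, hw]))
  simpa [(hasDerivAt_comp_line hf z w 0).deriv] using this

/-- Averages of an entire function over a continuous family of affine maps are entire. -/
theorem differentiable_integral_affine {n : ℕ} {f : Cn n → ℂ} (hf : Differentiable ℂ f)
    {a c : ℝ → ℂ} {b : ℝ → Cn n} (ha : Continuous a) (hb : Continuous b) (hc : Continuous c)
    (T : ℝ) :
    Differentiable ℂ (fun z => ∫ θ in Set.Ioc 0 T, c θ * f (a θ • z + b θ)) := by
  intro x
  have hfc := hf.continuous
  let K2 : Set (ℝ × (Cn n × Cn n)) :=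
    Set.Icc 0 T ×ˢ (Metric.closedBall x 1 ×ˢ Metric.closedBall 0 1)
  have hK2 : IsCompact K2 :=
    isCompact_Icc.prod ((isCompact_closedBall x 1).prod (isCompact_closedBall 0 1))
  obtain ⟨M, hM⟩ := hK2.exists_bound_of_continuousOn
    (f := fun q => f (a q.1 • q.2.1 + b q.1 + q.2.2)) (by fun_prop)
  obtain ⟨N, hN⟩ := (isCompact_Icc (a := (0 : ℝ)) (b := T)).exists_bound_of_continuousOn
    (f := fun θ => c θ * a θ) (by fun_prop)
  refine (hasFDerivAt_integral_of_dominated_of_fderiv_le (𝕜 := ℂ)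
    (μ := volume.restrict (Set.Ioc 0 T))
    (F := fun z θ => c θ * f (a θ • z + b θ))
    (F' := fun z θ => (c θ * a θ) • fderiv ℂ f (a θ • z + b θ))
    (bound := fun _ => N * M) (s := Metric.closedBall x 1)
    (Metric.closedBall_mem_nhds x one_pos) ?_ ?_ ?_ ?_ ?_ ?_).differentiableAt
  · exact Eventually.of_forall fun z => by
      apply Continuous.aestronglyMeasurable; fun_prop
  · have : Continuous fun θ => c θ * f (a θ • x + b θ) := by fun_prop
    exact (this.integrableOn_Icc).mono_set Set.Ioc_subset_Icc_self
  · have h1 : Measurable fun θ => fderiv ℂ f (a θ • x + b θ) :=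
      (measurable_fderiv ℂ f).comp (by fun_prop : Continuous fun θ => a θ • x + b θ).measurable
    have h2 : Continuous fun θ => c θ * a θ := by fun_prop
    exact (h2.measurable.smul h1).aestronglyMeasurable
  · rw [ae_restrict_iff' measurableSet_Ioc]
    refine Eventually.of_forall fun θ hθ z hz => ?_
    have hθ' := Set.Ioc_subset_Icc_self hθ
    rw [norm_smul]
    refine mul_le_mul (hN θ hθ') (norm_fderiv_le_of_forall_closedBall hf fun w hw => ?_)
      (norm_nonneg _) ((norm_nonneg _).trans (hN θ hθ'))
    have := hM (θ, (z, w - (a θ • z + b θ))) ⟨hθ', hz, by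
      simpa [dist_eq_norm] using hw⟩
    simpa using this
  · exact integrable_const _
  · refine Eventually.of_forall fun θ z _ => ?_
    have h1 : HasFDerivAt (fun z : Cn n => a θ • z + b θ)
        (a θ • ContinuousLinearMap.id ℂ (Cn n)) z :=
      ((hasFDerivAt_id z).const_smul (a θ)).add_const _
    have h2 := ((hf _).hasFDerivAt.comp z h1).const_mul (c θ)
    refine h2.congr_fderiv ?_
    ext w
    simp [mul_assoc]

/-- Taylor coefficients along a continuous family of affine lines depend holomorphically on the
base point. -/
theorem differentiable_iteratedDeriv_affine {n : ℕ} {f : Cn n → ℂ} (hf : Differentiable ℂ f)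
    {a : ℂ → ℂ} {b : ℂ → Cn n} (ha : Differentiable ℂ a) (hb : Differentiable ℂ b) (m : ℕ) :
    Differentiable ℂ (fun z => iteratedDeriv m (fun t => f (a t • z + b t)) 0) := by
  have key (z : Cn n) : iteratedDeriv m (fun t => f (a t • z + b t)) 0 =
      (2 * Real.pi * I / m.factorial)⁻¹ *
        ∫ θ in Set.Ioc 0 (2 * Real.pi), (circleMap 0 1 θ * I * (1 / circleMap 0 1 θ ^ (m + 1))) *
          f (a (circleMap 0 1 θ) • z + b (circleMap 0 1 θ)) := by
    have hd : Differentiable ℂ fun t => f (a t • z + b t) := by fun_prop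
    have := DifferentiableOn.circleIntegral_one_div_sub_center_pow_smul (c := 0) one_pos m
      hd.differentiableOn
    have h0 : (2 * Real.pi * I / m.factorial : ℂ) ≠ 0 := by
      simp [Nat.factorial_ne_zero]
    rw [eq_inv_mul_iff_mul_eq₀ h0, ← smul_eq_mul, ← this, circleIntegral,
      intervalIntegral.integral_of_le (by positivity)]
    simp [mul_assoc]
  simp_rw [key]
  refine (differentiable_integral_affine hf ?_ ?_ ?_ _).const_mul _
  · exact ha.continuous.comp (continuous_circleMap 0 1)
  · exact hb.continuous.comp (continuous_circleMap 0 1)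
  · refine ((continuous_circleMap 0 1).mul continuous_const).mul ?_
    exact continuous_const.div₀ ((continuous_circleMap 0 1).pow _) fun θ => by simp

/-- Partial derivatives of entire functions are entire. -/
theorem differentiable_pdz {n : ℕ} (j : Fin n) {f : Cn n → ℂ} (hf : Differentiable ℂ f) :
    Differentiable ℂ (pdz j f) := by
  have := differentiable_iteratedDeriv_affine hf (a := fun _ => 1)
    (b := fun t => t • Pi.single j 1) (by fun_prop) (by fun_prop) 1
  convert this using 2 with z
  simpa [pdz] using (hasDerivAt_comp_line hf z (Pi.single j 1) 0).deriv.symm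

theorem fderiv_apply_eq_sum_pdz {n : ℕ} (f : Cn n → ℂ) (z w : Cn n) :
    fderiv ℂ f z w = ∑ j, w j * pdz j f z := by
  conv_lhs => rw [pi_eq_sum_univ' w]
  simp [pdz]

/-- The homogeneous Taylor component of degree `m` at the origin. -/
def homComp {n : ℕ} (m : ℕ) (f : Cn n → ℂ) (z : Cn n) : ℂ :=
  (m.factorial : ℂ)⁻¹ * iteratedDeriv m (fun t : ℂ => f (t • z)) 0

theorem differentiable_homComp {n : ℕ} (m : ℕ) {f : Cn n → ℂ} (hf : Differentiable ℂ f) :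
    Differentiable ℂ (homComp m f) := by
  have := differentiable_iteratedDeriv_affine hf (a := fun t => t)
    (b := fun _ => 0) (by fun_prop) (by fun_prop) m
  simp only [add_zero] at this
  exact this.const_mul _

theorem homComp_smul {n : ℕ} (m : ℕ) {f : Cn n → ℂ} (hf : Differentiable ℂ f) (c : ℂ) (z : Cn n) :
    homComp m f (c • z) = c ^ m * homComp m f z := by
  have hd : Differentiable ℂ fun t : ℂ => f (t • z) := by fun_prop
  have := congrFun (iteratedDeriv_comp_const_mul (n := m) hd.contDiff c) 0
  simp only [mul_comm c, zero_mul] at this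
  simp only [homComp, smul_smul, this]
  ring

theorem hasSum_homComp {n : ℕ} {f : Cn n → ℂ} (hf : Differentiable ℂ f) (z : Cn n) :
    HasSum (fun m => homComp m f z) (f z) := by
  have hd : Differentiable ℂ fun t : ℂ => f (t • z) := by fun_prop
  simpa [homComp] using hasSum_taylorSeries_of_entire hd 0 1

/-- The homogeneous components decay geometrically, uniformly on bounded sets. -/
theorem exists_norm_homComp_le {n : ℕ} {f : Cn n → ℂ} (hf : Differentiable ℂ f) (R : ℝ) :
    ∃ C, ∀ m, ∀ z ∈ Metric.closedBall (0 : Cn n) R, ‖homComp m f z‖ ≤ C * (1 / 2) ^ m := by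
  obtain ⟨C, hC⟩ := (isCompact_closedBall (0 : Cn n) (2 * R)).exists_bound_of_continuousOn
    hf.continuous.continuousOn
  refine ⟨C, fun m z hz => ?_⟩
  have hd : Differentiable ℂ fun t : ℂ => f (t • z) := by fun_prop
  have := Complex.norm_iteratedDeriv_le_of_forall_mem_sphere_norm_le (c := 0) (C := C) m
    (two_pos : (0 : ℝ) < 2) hd.diffContOnCl (fun t ht => hC _ (by
      simp only [mem_sphere_iff_norm, sub_zero] at ht
      simpa [norm_smul, ht] using hz))
  have hm : (0 : ℝ) < m.factorial := by positivity
  rw [homComp, norm_mul, norm_inv, RCLike.norm_natCast, inv_mul_le_iff₀ hm]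
  refine this.trans (le_of_eq ?_)
  rw [one_div, inv_pow]
  ring

/-! ### Orthogonality of homogeneous components -/

theorem Orthonormal.hasSum_norm_sq {H ι : Type*} [NormedAddCommGroup H] [InnerProductSpace ℂ H]
    {v : ι → H} (hv : Orthonormal ℂ v) {a : ι → ℂ} {x : H} (h : HasSum (fun i => a i • v i) x) :
    HasSum (fun i => ‖a i‖ ^ 2) (‖x‖ ^ 2) := by
  refine ((continuous_norm.pow 2).continuousAt.tendsto.comp h).congr fun s => ?_
  simp only [Function.comp_apply, Pi.pow_apply]
  rw [norm_sq_eq_re_inner (𝕜 := ℂ), hv.inner_sum a a s, map_sum]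
  exact Finset.sum_congr rfl fun i _ => by
    rw [Complex.conj_mul', ← Complex.ofReal_pow]; exact Complex.ofReal_re _

/-- Parseval's identity for an absolutely convergent Fourier series. -/
theorem lintegral_fourier_sum {e : ℕ → ℤ} (he : Function.Injective e) {a : ℕ → ℂ}
    (ha : Summable fun m => ‖a m‖) {F : AddCircle (1 : ℝ) → ℂ}
    (hF : ∀ θ, HasSum (fun m => a m * fourier (e m) θ) (F θ)) :
    ∫⁻ θ, ‖F θ‖ₑ ^ 2 ∂AddCircle.haarAddCircle = ∑' m, ‖a m‖ₑ ^ 2 := by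
  have hs : Summable fun m => a m • (fourier (e m) : C(AddCircle (1 : ℝ), ℂ)) := by
    refine Summable.of_norm ?_
    simpa [norm_smul, fourier_norm] using ha
  obtain ⟨G, hG⟩ := hs
  have hGF : ∀ θ, G θ = F θ := fun θ => by
    have := ((ContinuousMap.evalCLM ℂ θ).hasSum hG)
    exact this.unique (by simpa using hF θ)
  have h1 := ((ContinuousMap.toLp 2 (AddCircle.haarAddCircle (T := 1)) ℂ).hasSum hG)
  simp only [map_smul] at h1
  have h2 := Orthonormal.hasSum_norm_sq (orthonormal_fourier.comp e he) h1
  have h3 : ‖ContinuousMap.toLp 2 (AddCircle.haarAddCircle (T := 1)) ℂ G‖ ^ 2 =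
      ∫ θ, ‖G θ‖ ^ 2 ∂AddCircle.haarAddCircle := by
    rw [norm_sq_eq_re_inner (𝕜 := ℂ), ContinuousMap.inner_toLp]
    simp_rw [Complex.mul_conj', ← Complex.ofReal_pow]
    rw [integral_complex_ofReal]
    exact Complex.ofReal_re _
  have h5 : Continuous fun θ => ‖G θ‖ ^ 2 := by fun_prop
  have h6 := ofReal_integral_eq_lintegral_ofReal
    (h5.integrable_of_hasCompactSupport (HasCompactSupport.of_compactSpace _)
      (μ := AddCircle.haarAddCircle (T := 1)))
    (Eventually.of_forall fun θ => by positivity)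
  have h7 (x : ℂ) : ENNReal.ofReal (‖x‖ ^ 2) = ‖x‖ₑ ^ 2 := by
    rw [ENNReal.ofReal_pow (norm_nonneg _), ofReal_norm]
  simp_rw [← hGF, ← h7]
  rw [← h6, ← h3, ← h2.tsum_eq, ENNReal.ofReal_tsum_of_nonneg (fun _ => by positivity) h2.summable]

/-- The squared Fock norm with values in `[0, ∞]`. -/
def fLNorm {n : ℕ} (f : Cn n → ℂ) : ENNReal :=
  ∫⁻ z : Cn n, ‖f z‖ₑ ^ 2 * ENNReal.ofReal (fWt z)

theorem continuous_fWt {n : ℕ} : Continuous (fWt : Cn n → ℝ) := by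
  unfold fWt; fun_prop

theorem fWt_pos {n : ℕ} (z : Cn n) : 0 < fWt z := Real.exp_pos _

theorem fWt_smul_of_norm_eq_one {n : ℕ} {c : ℂ} (hc : ‖c‖ = 1) (z : Cn n) :
    fWt (c • z) = fWt z := by
  simp [fWt, hc]

theorem measurePreserving_smul_of_norm_eq_one {n : ℕ} {c : ℂ} (hc : ‖c‖ = 1) :
    MeasurePreserving (fun z : Cn n => c • z) := by
  have h : MeasurePreserving (fun z : ℂ => c * z) := by
    have := (rotation ⟨c, by simpa [Submonoid.unitSphere] using hc⟩).measurePreserving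
    exact this
  exact volume_preserving_pi fun _ => h

theorem fLNorm_comp_smul {n : ℕ} {f : Cn n → ℂ} (hf : Continuous f) {c : ℂ} (hc : ‖c‖ = 1) :
    fLNorm (fun z => f (c • z)) = fLNorm f := by
  have hw := continuous_fWt (n := n)
  rw [fLNorm, fLNorm, ← (measurePreserving_smul_of_norm_eq_one hc).lintegral_comp
    (by fun_prop : Measurable fun z : Cn n => ‖f z‖ₑ ^ 2 * ENNReal.ofReal (fWt z))]
  simp [fWt_smul_of_norm_eq_one hc]

/-- An expansion of `f` into homogeneous continuous functions `g m` of distinct integral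
degrees `e m`. -/
structure HomExp {n : ℕ} (e : ℕ → ℤ) (f : Cn n → ℂ) (g : ℕ → Cn n → ℂ) : Prop where
  injective : Function.Injective e
  continuous_fun : Continuous f
  continuous_comp : ∀ m, Continuous (g m)
  hom : ∀ m (c : ℂ) z, c ≠ 0 → g m (c • z) = c ^ e m * g m z
  hasSum : ∀ z, HasSum (fun m => g m z) (f z)

/-- Components of different degrees are orthogonal in the Fock space. -/
theorem HomExp.fLNorm_eq {n : ℕ} {e : ℕ → ℤ} {f : Cn n → ℂ} {g : ℕ → Cn n → ℂ}
    (h : HomExp e f g) : fLNorm f = ∑' m, fLNorm (g m) := by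
  have hw := continuous_fWt (n := n)
  have hf := h.continuous_fun
  have hg := h.continuous_comp
  have hnorm (θ : AddCircle (1 : ℝ)) : ‖(fourier 1 θ : ℂ)‖ = 1 := by
    rw [fourier_one]; exact Circle.norm_coe _
  have hcirc (z : Cn n) : ∫⁻ θ : AddCircle (1 : ℝ), ‖f ((fourier 1 θ : ℂ) • z)‖ₑ ^ 2
      ∂AddCircle.haarAddCircle = ∑' m, ‖g m z‖ₑ ^ 2 := by
    refine lintegral_fourier_sum h.injective (h.hasSum z).summable.norm fun θ => ?_
    have h0 : (fourier 1 θ : ℂ) ≠ 0 := norm_ne_zero_iff.1 (by rw [hnorm]; exact one_ne_zero)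
    refine (h.hasSum ((fourier 1 θ : ℂ) • z)).congr_fun fun m => ?_
    rw [h.hom m _ z h0, mul_comm, fourier_one, fourier_apply, AddCircle.toCircle_zsmul,
      Circle.coe_zpow]
  calc fLNorm f = ∫⁻ θ : AddCircle (1 : ℝ), fLNorm (fun z => f ((fourier 1 θ : ℂ) • z))
        ∂AddCircle.haarAddCircle := by
        simp_rw [fun θ => fLNorm_comp_smul hf (hnorm θ)]
        simp
    _ = ∫⁻ z : Cn n, ∫⁻ θ : AddCircle (1 : ℝ), ‖f ((fourier 1 θ : ℂ) • z)‖ₑ ^ 2 *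
          ENNReal.ofReal (fWt z) ∂AddCircle.haarAddCircle := by
        unfold fLNorm
        refine lintegral_lintegral_swap ?_
        refine Measurable.aemeasurable ?_
        have : Continuous fun q : AddCircle (1 : ℝ) × Cn n => f ((fourier 1 q.1 : ℂ) • q.2) := by
          fun_prop
        exact (this.measurable.enorm.pow_const 2).mul
          (hw.measurable.comp measurable_snd).ennreal_ofReal
    _ = ∫⁻ z : Cn n, ∑' m, ‖g m z‖ₑ ^ 2 * ENNReal.ofReal (fWt z) := by
        refine lintegral_congr fun z => ?_
        rw [lintegral_mul_const' _ _ ENNReal.ofReal_ne_top, hcirc, ENNReal.tsum_mul_right]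
    _ = ∑' m, fLNorm (g m) := lintegral_tsum fun m => by
        have := hg m
        fun_prop

/-! ### Polynomial growth and integration by parts -/

/-- Entire functions of polynomial growth. -/
def PolyGrowth {n : ℕ} (f : Cn n → ℂ) : Prop :=
  Differentiable ℂ f ∧ ∃ (C : ℝ) (M : ℕ), ∀ z, ‖f z‖ ≤ C * (1 + ‖z‖) ^ M

theorem PolyGrowth.pdz {n : ℕ} {f : Cn n → ℂ} (hf : PolyGrowth f) (k : Fin n) :
    PolyGrowth (pdz k f) := by
  obtain ⟨hd, C, M, h⟩ := hf
  have hC : 0 ≤ C := by simpa using (norm_nonneg _).trans (h 0)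
  refine ⟨differentiable_pdz k hd, C * 2 ^ M, M, fun z => ?_⟩
  have h1 : ‖fderiv ℂ f z‖ ≤ C * (2 + ‖z‖) ^ M := by
    refine norm_fderiv_le_of_forall_closedBall hd fun w hw => (h w).trans ?_
    have : ‖w‖ ≤ ‖z‖ + 1 := by
      have := norm_le_norm_add_norm_sub' w z
      rw [mem_closedBall_iff_norm] at hw
      linarith
    exact mul_le_mul_of_nonneg_left (pow_le_pow_left₀ (by positivity) (by linarith) M) hC
  calc ‖_root_.pdz k f z‖ ≤ ‖fderiv ℂ f z‖ * ‖(Pi.single k 1 : Cn n)‖ :=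
        ContinuousLinearMap.le_opNorm _ _
    _ = ‖fderiv ℂ f z‖ := by rw [Pi.norm_single]; simp
    _ ≤ C * (2 + ‖z‖) ^ M := h1
    _ ≤ C * (2 * (1 + ‖z‖)) ^ M := by
        gcongr
        linarith [norm_nonneg z]
    _ = C * 2 ^ M * (1 + ‖z‖) ^ M := by rw [mul_pow]; ring

theorem PolyGrowth.coord_mul {n : ℕ} {f : Cn n → ℂ} (hf : PolyGrowth f) (k : Fin n) :
    PolyGrowth (fun z => z k * f z) := by
  obtain ⟨hd, C, M, h⟩ := hf
  refine ⟨by fun_prop, C, M + 1, fun z => ?_⟩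
  have h1 : ‖z k‖ ≤ 1 + ‖z‖ := (norm_le_pi_norm z k).trans (by linarith)
  rw [norm_mul, pow_succ]
  calc ‖z k‖ * ‖f z‖ ≤ (1 + ‖z‖) * (C * (1 + ‖z‖) ^ M) := by gcongr; exact h z
    _ = C * ((1 + ‖z‖) ^ M * (1 + ‖z‖)) := by ring

/-- Entire functions that are homogeneous of degree `m` have polynomial growth. -/
theorem PolyGrowth.of_homogeneous {n : ℕ} {f : Cn n → ℂ} (hf : Differentiable ℂ f) (m : ℕ)
    (h : ∀ (c : ℂ) z, f (c • z) = c ^ m * f z) : PolyGrowth f := by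
  obtain ⟨C, hC⟩ := (isCompact_closedBall (0 : Cn n) 1).exists_bound_of_continuousOn
    hf.continuous.continuousOn
  refine ⟨hf, C, m, fun z => ?_⟩
  have h0 : (0 : ℝ) < 1 + ‖z‖ := by positivity
  have h0' : ((1 + ‖z‖ : ℝ) : ℂ) ≠ 0 := by exact_mod_cast h0.ne'
  have h1 := h ((1 + ‖z‖ : ℝ) : ℂ) (((1 + ‖z‖ : ℝ) : ℂ)⁻¹ • z)
  rw [smul_inv_smul₀ h0'] at h1
  have hn : ‖((1 + ‖z‖ : ℝ) : ℂ)‖ = 1 + ‖z‖ := by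
    rw [Complex.norm_real, Real.norm_of_nonneg h0.le]
  rw [h1, norm_mul, norm_pow, hn, mul_comm]
  gcongr
  refine hC _ ?_
  rw [mem_closedBall_zero_iff, norm_smul, norm_inv, hn, inv_mul_le_iff₀ h0]
  linarith

theorem exists_one_add_norm_pow_mul_fWt_le (n M : ℕ) :
    ∃ C : ℝ, ∀ z : Cn n, (1 + ‖z‖) ^ M * fWt z ≤ C := by
  refine ⟨M.factorial * Real.exp (5 / 4), fun z => ?_⟩
  have h1 : (1 + ‖z‖) ^ M ≤ M.factorial * Real.exp (1 + ‖z‖) := by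
    have := Real.pow_div_factorial_le_exp (1 + ‖z‖) (by positivity) M
    rwa [div_le_iff₀' (by positivity)] at this
  have h2 : ‖z‖ ^ 2 ≤ ∑ j, ‖z j‖ ^ 2 := by
    have h3 : ‖z‖ ≤ Real.sqrt (∑ j, ‖z j‖ ^ 2) := by
      refine (pi_norm_le_iff_of_nonneg (Real.sqrt_nonneg _)).2 fun j => Real.le_sqrt_of_sq_le ?_
      exact Finset.single_le_sum (f := fun j => ‖z j‖ ^ 2) (fun _ _ => by positivity)
        (Finset.mem_univ j)
    calc ‖z‖ ^ 2 ≤ Real.sqrt (∑ j, ‖z j‖ ^ 2) ^ 2 := by gcongr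
      _ = _ := Real.sq_sqrt (by positivity)
  calc (1 + ‖z‖) ^ M * fWt z
      ≤ (M.factorial * Real.exp (1 + ‖z‖)) * Real.exp (-‖z‖ ^ 2) := by
        unfold fWt
        gcongr
    _ = M.factorial * Real.exp (1 + ‖z‖ + -‖z‖ ^ 2) := by rw [mul_assoc, ← Real.exp_add]
    _ ≤ _ := by
        gcongr
        nlinarith [sq_nonneg (‖z‖ - 1 / 2)]

theorem integrable_of_growth {n : ℕ} {h : Cn n → ℂ} (hc : Continuous h) {C : ℝ} {M : ℕ}
    (hb : ∀ z, ‖h z‖ ≤ C * (1 + ‖z‖) ^ M) : Integrable fun z => h z * fWt z := by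
  have hC : 0 ≤ C := by simpa using (norm_nonneg _).trans (hb 0)
  let d := Module.finrank ℝ (Cn n) + 1
  obtain ⟨K, hK⟩ := exists_one_add_norm_pow_mul_fWt_le n (M + d)
  have hint : Integrable fun z : Cn n => C * K * (1 + ‖z‖) ^ (-(d : ℝ)) :=
    (integrable_one_add_norm (by simp [d])).const_mul _
  refine hint.mono' ?_ (Eventually.of_forall fun z => ?_)
  · have := continuous_fWt (n := n)
    exact Continuous.aestronglyMeasurable (by fun_prop)
  · have h0 : (0 : ℝ) < 1 + ‖z‖ := by positivity
    rw [norm_mul, Complex.norm_real, Real.norm_of_nonneg (fWt_pos z).le, Real.rpow_neg h0.le,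
      Real.rpow_natCast, ← div_eq_mul_inv, le_div_iff₀ (by positivity)]
    have h1 := hK z
    have h2 := fWt_pos z
    calc ‖h z‖ * fWt z * (1 + ‖z‖) ^ d ≤ C * (1 + ‖z‖) ^ M * fWt z * (1 + ‖z‖) ^ d := by
          gcongr; exact hb z
      _ = C * ((1 + ‖z‖) ^ (M + d) * fWt z) := by rw [pow_add]; ring
      _ ≤ C * K := by gcongr

theorem PolyGrowth.integrable_fInner {n : ℕ} {f g : Cn n → ℂ} (hf : PolyGrowth f)
    (hg : PolyGrowth g) :
    Integrable fun z => f z * (starRingEnd ℂ) (g z) * fWt z := by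
  obtain ⟨hf, C, M, hC⟩ := hf
  obtain ⟨hg, D, N, hD⟩ := hg
  have hfc := hf.continuous
  have hgc := hg.continuous
  have hC0 : 0 ≤ C := by simpa using (norm_nonneg _).trans (hC 0)
  refine integrable_of_growth (C := C * D) (M := M + N) ?_ fun z => ?_
  · exact hfc.mul (Complex.continuous_conj.comp hgc)
  · rw [norm_mul, RCLike.norm_conj, pow_add]
    calc ‖f z‖ * ‖g z‖ ≤ (C * (1 + ‖z‖) ^ M) * (D * (1 + ‖z‖) ^ N) := by
          gcongr
          exacts [hC z, hD z]
      _ = _ := by ring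

theorem hasLineDerivAt_fWt {n : ℕ} (z v : Cn n) :
    HasLineDerivAt ℝ (fun z => (fWt z : ℂ))
      (((fWt z * -∑ j, 2 * inner ℝ (z j) (v j) : ℝ)) : ℂ) z v := by
  have h1 (j : Fin n) : HasDerivAt (fun t : ℝ => ‖(z + t • v) j‖ ^ 2)
      (2 * inner ℝ (z j) (v j)) 0 := by
    have h2 : HasDerivAt (fun t : ℝ => z j + t • v j) (v j) 0 := by
      simpa using ((hasDerivAt_id (0 : ℝ)).smul_const (v j)).const_add (z j)
    simpa using h2.norm_sq
  have h3 := ((HasDerivAt.fun_sum fun j (_ : j ∈ Finset.univ) => h1 j).neg.exp).ofReal_comp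
  simpa [HasLineDerivAt, fWt] using h3

theorem hasLineDerivAt_of_differentiable {n : ℕ} {f : Cn n → ℂ} (hf : Differentiable ℂ f)
    (z v : Cn n) : HasLineDerivAt ℝ f (fderiv ℂ f z v) z v := by
  have h := (hf z).hasFDerivAt.restrictScalars ℝ
  exact h.hasLineDerivAt v

theorem fderiv_apply_single {n : ℕ} (f : Cn n → ℂ) (z : Cn n) (k : Fin n) (ε : ℂ) :
    fderiv ℂ f z (Pi.single k ε) = ε * pdz k f z := by
  have : (Pi.single k ε : Cn n) = ε • Pi.single k 1 := by
    rw [← Pi.single_smul]; simp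
  rw [this, map_smul, pdz, smul_eq_mul]

/-- Integration by parts in the real direction `ε` of the `k`-th coordinate. -/
theorem integral_by_parts_direction {n : ℕ} {f g : Cn n → ℂ} (hf : PolyGrowth f)
    (hg : PolyGrowth g) (k : Fin n) (ε : ℂ) :
    ∫ z, f z * (starRingEnd ℂ) (g z) * fWt z * (2 * (inner ℝ (z k) ε : ℝ) : ℂ) =
      ε * fInner (pdz k f) g + (starRingEnd ℂ) ε * fInner f (pdz k g) := by
  have hfg' := (hf.coord_mul k).integrable_fInner hg
  have hfg'' := hf.integrable_fInner (hg.coord_mul k)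
  have hA := (hf.pdz k).integrable_fInner hg
  have hB := hf.integrable_fInner (hg.pdz k)
  have hinner (w : ℂ) : ((inner ℝ w ε : ℝ) : ℂ) * 2 =
      (starRingEnd ℂ) ε * w + ε * (starRingEnd ℂ) w := by
    apply Complex.ext <;> simp [Complex.inner] <;> ring
  have key := integral_bilinear_hasLineDerivAt_right_eq_neg_left_of_integrable
    (μ := (volume : Measure (Cn n))) (B := ContinuousLinearMap.mul ℝ ℂ)
    (f := fun z => f z * (starRingEnd ℂ) (g z))
    (f' := fun z => ε * pdz k f z * (starRingEnd ℂ) (g z) +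
      f z * (starRingEnd ℂ) (ε * pdz k g z))
    (g := fun z => (fWt z : ℂ))
    (g' := fun z => ((fWt z * -∑ j, 2 * inner ℝ (z j) ((Pi.single k ε : Cn n) j) : ℝ) : ℂ))
    (v := Pi.single k ε) ?_ ?_ ?_ ?_ ?_
  · simp only [ContinuousLinearMap.mul_apply'] at key
    rw [fInner, fInner, ← integral_const_mul, ← integral_const_mul,
      ← integral_add (hA.const_mul _) (hB.const_mul _), ← neg_inj, ← integral_neg]
    convert key using 3 with z
    · rw [Finset.sum_eq_single k (fun j _ hj => by simp [hj]) (by simp)]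
      simp only [Pi.single_eq_same]
      push_cast
      ring
    · rfl
    · funext z
      simp only [map_mul]
      ring
  · simp only [ContinuousLinearMap.mul_apply']
    refine ((hA.const_mul ε).add (hB.const_mul ((starRingEnd ℂ) ε))).congr
      (Eventually.of_forall fun z => ?_)
    simp only [Pi.add_apply, map_mul]
    ring
  · simp only [ContinuousLinearMap.mul_apply']
    refine ((hfg'.const_mul (-(starRingEnd ℂ) ε)).add (hfg''.const_mul (-ε))).congr
      (Eventually.of_forall fun z => ?_)
    simp only [Pi.add_apply, map_mul]
    rw [Finset.sum_eq_single k (fun j _ hj => by simp [hj]) (by simp)]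
    simp only [Pi.single_eq_same]
    push_cast
    linear_combination (f z * (starRingEnd ℂ) (g z) * (fWt z : ℂ)) * hinner (z k)
  · simpa using hf.integrable_fInner hg
  · intro z _
    have h1 := hasLineDerivAt_of_differentiable hf.1 z (Pi.single k ε)
    have h2 := hasLineDerivAt_of_differentiable hg.1 z (Pi.single k ε)
    rw [fderiv_apply_single] at h1 h2
    have h3 := HasDerivAt.fun_mul h1 (HasDerivAt.star h2)
    simp only [zero_smul, add_zero] at h3
    exact h3
  · intro z _
    exact hasLineDerivAt_fWt z _

/-- On functions of polynomial growth, multiplication by `z_k` is adjoint to `∂/∂z_k`. -/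
theorem fInner_pdz_left {n : ℕ} {f g : Cn n → ℂ} (hf : PolyGrowth f) (hg : PolyGrowth g)
    (k : Fin n) : fInner (pdz k f) g = fInner f (fun z => z k * g z) := by
  have h1 := integral_by_parts_direction hf hg k 1
  have h2 := integral_by_parts_direction hf hg k I
  have hfg' := (hf.coord_mul k).integrable_fInner hg
  have hfg'' := hf.integrable_fInner (hg.coord_mul k)
  have i1 : Integrable fun z => f z * (starRingEnd ℂ) (g z) * fWt z *
      (2 * (inner ℝ (z k) (1 : ℂ) : ℝ) : ℂ) := by
    refine (hfg'.add hfg'').congr (Eventually.of_forall fun z => ?_)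
    simp only [Pi.add_apply, map_mul]
    have : (2 * (inner ℝ (z k) (1 : ℂ) : ℝ) : ℂ) = z k + (starRingEnd ℂ) (z k) := by
      apply Complex.ext <;> simp [Complex.inner]; ring
    rw [this]; ring
  have i2 : Integrable fun z => f z * (starRingEnd ℂ) (g z) * fWt z *
      (2 * (inner ℝ (z k) I : ℝ) : ℂ) := by
    refine ((hfg'.const_mul (-I)).add (hfg''.const_mul I)).congr (Eventually.of_forall fun z => ?_)
    simp only [Pi.add_apply, map_mul]
    have : (2 * (inner ℝ (z k) I : ℝ) : ℂ) = -I * z k + I * (starRingEnd ℂ) (z k) := by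
      apply Complex.ext <;> simp [Complex.inner]; ring
    rw [this]; ring
  have h3 : 2 * fInner f (fun z => z k * g z) =
      (∫ z, f z * (starRingEnd ℂ) (g z) * fWt z * (2 * (inner ℝ (z k) (1 : ℂ) : ℝ) : ℂ)) -
      I * ∫ z, f z * (starRingEnd ℂ) (g z) * fWt z * (2 * (inner ℝ (z k) I : ℝ) : ℂ) := by
    rw [← integral_const_mul, ← integral_sub i1 (i2.const_mul I), fInner, ← integral_const_mul]
    congr 1
    ext z
    have : (starRingEnd ℂ) (z k) =
        ((inner ℝ (z k) (1 : ℂ) : ℝ) : ℂ) - I * ((inner ℝ (z k) I : ℝ) : ℂ) := by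
      apply Complex.ext <;> simp [Complex.inner]
    simp only [map_mul, this]
    ring
  rw [h1, h2] at h3
  simp only [map_one, Complex.conj_I] at h3
  linear_combination (-1 / 2) * h3 + (1 / 2) * (fInner (pdz k f) g - fInner f (pdz k g)) * I_sq

/-! ### Fock norms of homogeneous functions -/

theorem fLNorm_eq_lintegral_ofReal {n : ℕ} (f : Cn n → ℂ) :
    fLNorm f = ∫⁻ z, ENNReal.ofReal (‖f z‖ ^ 2 * fWt z) := by
  refine lintegral_congr fun z => ?_
  rw [ENNReal.ofReal_mul (by positivity), ENNReal.ofReal_pow (norm_nonneg _), ofReal_norm]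

theorem norm_sq_mul_fWt_nonneg {n : ℕ} (f : Cn n → ℂ) (z : Cn n) : 0 ≤ ‖f z‖ ^ 2 * fWt z :=
  mul_nonneg (by positivity) (fWt_pos z).le

theorem fNormSq_nonneg {n : ℕ} (f : Cn n → ℂ) : 0 ≤ fNormSq f :=
  integral_nonneg (norm_sq_mul_fWt_nonneg f)

theorem memF_iff_fLNorm_ne_top {n : ℕ} {f : Cn n → ℂ} (hf : Differentiable ℂ f) :
    MemF f ↔ fLNorm f ≠ ⊤ := by
  have hc := hf.continuous
  have hw := continuous_fWt (n := n)
  have hm : AEStronglyMeasurable (fun z => ‖f z‖ ^ 2 * fWt z) volume :=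
    Continuous.aestronglyMeasurable (by fun_prop)
  rw [MemF, fLNorm_eq_lintegral_ofReal, ← lt_top_iff_ne_top, Integrable,
    hasFiniteIntegral_iff_ofReal (Eventually.of_forall (norm_sq_mul_fWt_nonneg f))]
  simp [hf, hm]

theorem fNormSq_eq_toReal_fLNorm {n : ℕ} {f : Cn n → ℂ} (hf : Continuous f) :
    fNormSq f = (fLNorm f).toReal := by
  have hw := continuous_fWt (n := n)
  rw [fLNorm_eq_lintegral_ofReal]
  exact integral_eq_lintegral_of_nonneg_ae (Eventually.of_forall (norm_sq_mul_fWt_nonneg f))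
    (Continuous.aestronglyMeasurable (by fun_prop))

theorem fInner_self {n : ℕ} (f : Cn n → ℂ) : fInner f f = fNormSq f := by
  rw [fInner, fNormSq, ← integral_complex_ofReal]
  refine integral_congr_ae (Eventually.of_forall fun z => ?_)
  simp only [Complex.mul_conj, Complex.normSq_eq_norm_sq]
  push_cast
  rfl

theorem PolyGrowth.memF {n : ℕ} {f : Cn n → ℂ} (hf : PolyGrowth f) : MemF f := by
  refine ⟨hf.1, ?_⟩
  refine (hf.integrable_fInner hf).re.congr (Eventually.of_forall fun z => ?_)
  simp only [Complex.mul_conj, Complex.normSq_eq_norm_sq, RCLike.re_to_complex,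
    ← Complex.ofReal_mul, Complex.ofReal_re]

theorem PolyGrowth.fLNorm_eq {n : ℕ} {f : Cn n → ℂ} (hf : PolyGrowth f) :
    fLNorm f = ENNReal.ofReal (fNormSq f) := by
  rw [fNormSq_eq_toReal_fLNorm hf.1.continuous,
    ENNReal.ofReal_toReal ((memF_iff_fLNorm_ne_top hf.1).1 hf.memF)]

/-- Euler's identity. -/
theorem sum_coord_mul_pdz_of_homogeneous {n : ℕ} {h : Cn n → ℂ} (hd : Differentiable ℂ h)
    {e : ℤ} (hh : ∀ (c : ℂ) z, c ≠ 0 → h (c • z) = c ^ e * h z) (z : Cn n) :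
    ∑ j, z j * pdz j h z = e * h z := by
  have h1 : HasDerivAt (fun s : ℂ => h (s • z)) (fderiv ℂ h z z) 1 := by
    simpa using hasDerivAt_comp_line hd 0 z 1
  have h2 : HasDerivAt (fun s : ℂ => s ^ e * h z) (e * h z) 1 := by
    simpa using (hasDerivAt_zpow e (1 : ℂ) (Or.inl one_ne_zero)).mul_const (h z)
  rw [← fderiv_apply_eq_sum_pdz]
  refine h1.unique (h2.congr_of_eventuallyEq ?_)
  filter_upwards [isOpen_ne.mem_nhds (one_ne_zero : (1 : ℂ) ≠ 0)] with s hs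
  exact hh s z hs

theorem pdz_of_homogeneous {n : ℕ} {h : Cn n → ℂ} (hd : Differentiable ℂ h)
    {e : ℤ} (hh : ∀ (c : ℂ) z, c ≠ 0 → h (c • z) = c ^ e * h z) (k : Fin n)
    (c : ℂ) (z : Cn n) (hc : c ≠ 0) : pdz k h (c • z) = c ^ (e - 1) * pdz k h z := by
  have h1 : HasDerivAt (fun s : ℂ => h (c • (z + s • Pi.single k 1)))
      (c * pdz k h (c • z)) 0 := by
    have := hasDerivAt_comp_line hd (c • z) (c • Pi.single k 1) 0
    simp only [zero_smul, add_zero, map_smul, smul_eq_mul] at this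
    refine this.congr_of_eventuallyEq (Eventually.of_forall fun s => ?_)
    simp only [smul_add, smul_comm c s]
  have h2 : HasDerivAt (fun s : ℂ => c ^ e * h (z + s • Pi.single k 1)) (c ^ e * pdz k h z) 0 := by
    have := (hasDerivAt_comp_line hd z (Pi.single k 1) 0).const_mul (c ^ e)
    simpa [pdz] using this
  simp only [hh c _ hc] at h1
  rw [zpow_sub_one₀ hc, ← mul_right_comm, h2.unique h1]
  field_simp

theorem sum_fNormSq_pdz {n : ℕ} {h : Cn n → ℂ} (hh : PolyGrowth h) {a : ℝ}
    (ha : ∀ z, ∑ j, z j * pdz j h z = a * h z) :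
    ∑ k, fNormSq (pdz k h) = a * fNormSq h := by
  have h1 : ∑ k, fInner (pdz k h) (pdz k h) = a * fInner h h := by
    simp_rw [fun k => fInner_pdz_left hh (hh.pdz k) k]
    unfold fInner
    rw [← integral_finsetSum _
      fun k _ => hh.integrable_fInner ((hh.pdz k).coord_mul k), ← integral_const_mul]
    refine integral_congr_ae (Eventually.of_forall fun z => ?_)
    simp only
    rw [← Finset.sum_mul, ← Finset.mul_sum, ← map_sum, ha z, map_mul, Complex.conj_ofReal]
    ring
  simp_rw [fInner_self] at h1
  exact_mod_cast h1

theorem fNormSq_pdz_le {n : ℕ} {h : Cn n → ℂ} (hh : PolyGrowth h) {a : ℝ}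
    (ha : ∀ z, ∑ j, z j * pdz j h z = a * h z) (k : Fin n) :
    fNormSq (pdz k h) ≤ a * fNormSq h := by
  rw [← sum_fNormSq_pdz hh ha]
  exact Finset.single_le_sum (f := fun k => fNormSq (pdz k h)) (fun _ _ => fNormSq_nonneg _)
    (Finset.mem_univ k)

theorem pdz_coord_mul {n : ℕ} {f : Cn n → ℂ} (hf : Differentiable ℂ f) (j k : Fin n) (z : Cn n) :
    pdz k (fun z => z j * f z) z = (if j = k then f z else 0) + z j * pdz k f z := by
  have h1 : HasFDerivAt (fun z : Cn n => z j) (ContinuousLinearMap.proj (R := ℂ) j) z :=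
    (ContinuousLinearMap.proj (R := ℂ) (φ := fun _ : Fin n => ℂ) j).hasFDerivAt
  have h2 := h1.fun_mul (hf z).hasFDerivAt
  rw [pdz, h2.fderiv]
  simp [Pi.single_apply, pdz, add_comm]

theorem fNormSq_coord_mul {n : ℕ} {h : Cn n → ℂ} (hh : PolyGrowth h) (j : Fin n) :
    fNormSq (fun z => z j * h z) = fNormSq h + fNormSq (pdz j h) := by
  have h1 := fInner_pdz_left (hh.coord_mul j) hh j
  have h2 := fInner_pdz_left hh (hh.pdz j) j
  have h3 : fInner (pdz j (fun z => z j * h z)) h =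
      fInner h h + (starRingEnd ℂ) (fInner h (fun z => z j * pdz j h z)) := by
    unfold fInner
    rw [← integral_conj, ← integral_add (hh.integrable_fInner hh)]
    · refine integral_congr_ae (Eventually.of_forall fun z => ?_)
      simp only [pdz_coord_mul hh.1, if_true, map_mul, Complex.conj_conj, Complex.conj_ofReal]
      ring
    · have := (hh.integrable_fInner ((hh.pdz j).coord_mul j))
      exact (Complex.conjLIE.toContinuousLinearEquiv.toContinuousLinearMap).integrable_comp this
  rw [h3, ← h2, fInner_self, fInner_self, fInner_self, Complex.conj_ofReal] at h1
  exact_mod_cast h1.symm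

theorem fNormSq_coord_mul_le {n : ℕ} {h : Cn n → ℂ} (hh : PolyGrowth h) {a : ℝ}
    (ha : ∀ z, ∑ j, z j * pdz j h z = a * h z) (j : Fin n) :
    fNormSq (fun z => z j * h z) ≤ (a + 1) * fNormSq h := by
  rw [fNormSq_coord_mul hh]
  linarith [fNormSq_pdz_le hh ha j]

/-! ### The Fock space is a vector space -/

theorem memF_zero {n : ℕ} : MemF (0 : Cn n → ℂ) := by
  refine ⟨differentiable_const 0, ?_⟩
  simp

theorem MemF.const_mul {n : ℕ} {f : Cn n → ℂ} (hf : MemF f) (c : ℂ) : MemF fun z => c * f z := by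
  refine ⟨hf.1.const_mul c, (hf.2.const_mul (‖c‖ ^ 2)).congr (Eventually.of_forall fun z => ?_)⟩
  simp only [norm_mul]
  ring

theorem MemF.add {n : ℕ} {f g : Cn n → ℂ} (hf : MemF f) (hg : MemF g) :
    MemF fun z => f z + g z := by
  have hfc := hf.1.continuous
  have hgc := hg.1.continuous
  have hw := continuous_fWt (n := n)
  refine ⟨hf.1.add hg.1, ((hf.2.add hg.2).const_mul 2).mono'
    (Continuous.aestronglyMeasurable (by fun_prop)) (Eventually.of_forall fun z => ?_)⟩
  have h0 := fWt_pos z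
  rw [Real.norm_of_nonneg (by positivity)]
  have h1 : ‖f z + g z‖ ^ 2 ≤ 2 * (‖f z‖ ^ 2 + ‖g z‖ ^ 2) :=
    (pow_le_pow_left₀ (norm_nonneg _) (norm_add_le _ _) 2).trans add_sq_le
  simp only [Pi.add_apply]
  calc ‖f z + g z‖ ^ 2 * fWt z ≤ 2 * (‖f z‖ ^ 2 + ‖g z‖ ^ 2) * fWt z := by gcongr
    _ = _ := by ring

theorem MemF.sum {n : ℕ} {ι : Type*} {s : Finset ι} {f : ι → Cn n → ℂ}
    (h : ∀ i ∈ s, MemF (f i)) : MemF fun z => ∑ i ∈ s, f i z := by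
  classical
  induction s using Finset.induction_on with
  | empty => exact memF_zero
  | insert a s ha ih =>
    simp only [Finset.sum_insert ha]
    exact (h a (by simp)).add (ih fun i hi => h i (by simp [hi]))

/-! ### Homogeneous expansions and the Euler operator -/

theorem homExp_homComp {n : ℕ} {f : Cn n → ℂ} (hf : Differentiable ℂ f) :
    HomExp (fun m => (m : ℤ)) f (fun m => homComp m f) where
  injective := Nat.cast_injective
  continuous_fun := hf.continuous
  continuous_comp m := (differentiable_homComp m hf).continuous
  hom m c z _ := by rw [homComp_smul m hf, zpow_natCast]
  hasSum := hasSum_homComp hf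

theorem hasSum_pdz_homComp {n : ℕ} {f : Cn n → ℂ} (hf : Differentiable ℂ f) (k : Fin n)
    (z : Cn n) : HasSum (fun m => pdz k (homComp m f) z) (pdz k f z) := by
  obtain ⟨C, hC⟩ := exists_norm_homComp_le hf (‖z‖ + 1)
  have hs : Summable fun m : ℕ => C * (1 / 2 : ℝ) ^ m := summable_geometric_two.mul_left C
  have key := Complex.hasSum_deriv_of_summable_norm (U := Metric.ball (0 : ℂ) 1) (z := 0)
    (F := fun m s => homComp m f (z + s • Pi.single k 1)) hs
    (fun m => by
      have := differentiable_homComp m hf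
      exact Differentiable.differentiableOn (by fun_prop))
    Metric.isOpen_ball
    (fun m s hs => hC m _ (by
      rw [mem_ball_zero_iff] at hs
      rw [mem_closedBall_zero_iff]
      refine (norm_add_le _ _).trans ?_
      rw [norm_smul, Pi.norm_single, norm_one, mul_one]
      linarith)) (by simp)
  simp only [fun s : ℂ => (hasSum_homComp hf (z + s • Pi.single k 1)).tsum_eq] at key
  rw [(hasDerivAt_comp_line hf z (Pi.single k 1) 0).deriv] at key
  simp only [fun m => (hasDerivAt_comp_line (differentiable_homComp m hf) z
    (Pi.single k 1) 0).deriv] at key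
  simpa [pdz] using key

theorem homExp_pdz {n : ℕ} {f : Cn n → ℂ} (hf : Differentiable ℂ f) (k : Fin n) :
    HomExp (fun m => (m : ℤ) - 1) (pdz k f) (fun m => pdz k (homComp m f)) where
  injective a b h := by simpa using h
  continuous_fun := (differentiable_pdz k hf).continuous
  continuous_comp m := (differentiable_pdz k (differentiable_homComp m hf)).continuous
  hom m c z hc := pdz_of_homogeneous (differentiable_homComp m hf)
    (fun c z hc => (homExp_homComp hf).hom m c z hc) k c z hc
  hasSum := hasSum_pdz_homComp hf k

theorem HomExp.coord_mul {n : ℕ} {e : ℕ → ℤ} {f : Cn n → ℂ} {g : ℕ → Cn n → ℂ}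
    (h : HomExp e f g) (j : Fin n) :
    HomExp (fun m => e m + 1) (fun z => z j * f z) (fun m z => z j * g m z) where
  injective a b hab := h.injective (by simpa using hab)
  continuous_fun := (continuous_apply j).mul h.continuous_fun
  continuous_comp m := (continuous_apply j).mul (h.continuous_comp m)
  hom m c z hc := by
    rw [h.hom m c z hc, zpow_add_one₀ hc, Pi.smul_apply, smul_eq_mul]
    ring
  hasSum z := (h.hasSum z).mul_left (z j)

theorem polyGrowth_homComp {n : ℕ} {f : Cn n → ℂ} (hf : Differentiable ℂ f) (m : ℕ) :
    PolyGrowth (homComp m f) :=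
  .of_homogeneous (differentiable_homComp m hf) m (homComp_smul m hf)

theorem sum_coord_mul_pdz_homComp {n : ℕ} {f : Cn n → ℂ} (hf : Differentiable ℂ f) (m : ℕ)
    (z : Cn n) : ∑ j, z j * pdz j (homComp m f) z = m * homComp m f z := by
  have := sum_coord_mul_pdz_of_homogeneous (differentiable_homComp m hf)
    (fun c z hc => (homExp_homComp hf).hom m c z hc) z
  simpa using this

theorem homExp_euler {n : ℕ} {u v : Cn n → ℂ} (hu : Differentiable ℂ u) (hv : Continuous v)
    (p : ℕ) (huv : ∀ z, ∑ j, z j * pdz j u z + p * u z = v z) :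
    HomExp (fun m => (m : ℤ)) v (fun m z => ((m + p : ℝ) : ℂ) * homComp m u z) where
  injective := Nat.cast_injective
  continuous_fun := hv
  continuous_comp m := continuous_const.mul (differentiable_homComp m hu).continuous
  hom m c z hc := by
    rw [(homExp_homComp hu).hom m c z hc]
    ring
  hasSum z := by
    have h1 := hasSum_sum fun j (_ : j ∈ (Finset.univ : Finset (Fin n))) =>
      (hasSum_pdz_homComp hu j z).mul_left (z j)
    have h2 := h1.add ((hasSum_homComp hu z).mul_left (p : ℂ))
    rw [huv] at h2
    refine h2.congr_fun fun m => ?_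
    rw [sum_coord_mul_pdz_homComp hu]
    push_cast
    ring

theorem fLNorm_const_mul {n : ℕ} (a : ℝ) {f : Cn n → ℂ} :
    fLNorm (fun z => (a : ℂ) * f z) = ENNReal.ofReal (a ^ 2) * fLNorm f := by
  simp only [fLNorm]
  rw [← lintegral_const_mul' _ _ ENNReal.ofReal_ne_top]
  refine lintegral_congr fun z => ?_
  rw [enorm_mul, mul_pow, ← mul_assoc, ← ofReal_norm (a : ℂ), Complex.norm_real,
    ← ENNReal.ofReal_pow (norm_nonneg _), Real.norm_eq_abs, sq_abs]

/-- An expansion controlled by `(m + p) • homComp m u` is controlled by `(E + p) u`. -/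
theorem mul_fLNorm_le_of_homExp {n : ℕ} {u v w : Cn n → ℂ} (hu : Differentiable ℂ u)
    (hv : Continuous v) {p : ℕ} (huv : ∀ z, ∑ j, z j * pdz j u z + p * u z = v z)
    {e : ℕ → ℤ} {g : ℕ → Cn n → ℂ} (hw : HomExp e w g) (hg : ∀ m, PolyGrowth (g m)) {a : ℝ}
    (ha : 0 ≤ a) (hle : ∀ m : ℕ, a * fNormSq (g m) ≤ (m + p) ^ 2 * fNormSq (homComp m u)) :
    ENNReal.ofReal a * fLNorm w ≤ fLNorm v := by
  rw [hw.fLNorm_eq, (homExp_euler hu hv p huv).fLNorm_eq, ← ENNReal.tsum_mul_left]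
  refine ENNReal.tsum_le_tsum fun m => ?_
  rw [fLNorm_const_mul, (hg m).fLNorm_eq, (polyGrowth_homComp hu m).fLNorm_eq,
    ← ENNReal.ofReal_mul ha, ← ENNReal.ofReal_mul (by positivity)]
  exact ENNReal.ofReal_le_ofReal (hle m)

/-- If `(E + p) u = v` with `E` the Euler operator, then `‖u‖ ≤ ‖v‖ / p`. -/
theorem fNormSq_le_of_euler {n : ℕ} {u v : Cn n → ℂ} (hu : Differentiable ℂ u) (hv : MemF v)
    {p : ℕ} (hp : 1 ≤ p) (huv : ∀ z, ∑ j, z j * pdz j u z + p * u z = v z) :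
    fNormSq u ≤ (1 / p) ^ 2 * fNormSq v := by
  have h := mul_fLNorm_le_of_homExp hu hv.1.continuous huv (homExp_homComp hu)
    (polyGrowth_homComp hu) (a := (p : ℝ) ^ 2) (by positivity) fun m => by
      have := fNormSq_nonneg (homComp m u)
      gcongr
      linarith [(Nat.cast_nonneg m : (0 : ℝ) ≤ m)]
  have h1 := ENNReal.toReal_mono ((memF_iff_fLNorm_ne_top hv.1).1 hv) h
  rw [ENNReal.toReal_mul, ENNReal.toReal_ofReal (by positivity),
    ← fNormSq_eq_toReal_fLNorm hu.continuous, ← fNormSq_eq_toReal_fLNorm hv.1.continuous] at h1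
  have hp0 : (0 : ℝ) < p := by exact_mod_cast hp
  rw [div_pow, one_pow, one_div, ← div_eq_inv_mul, le_div_iff₀' (by positivity)]
  exact h1

theorem memF_of_homExp {n : ℕ} {u v w : Cn n → ℂ} (hu : Differentiable ℂ u) (hv : MemF v)
    {p : ℕ} (hp : 1 ≤ p) (huv : ∀ z, ∑ j, z j * pdz j u z + p * u z = v z)
    (hwd : Differentiable ℂ w)
    {e : ℕ → ℤ} {g : ℕ → Cn n → ℂ} (hw : HomExp e w g) (hg : ∀ m, PolyGrowth (g m))
    (hle : ∀ m : ℕ, fNormSq (g m) ≤ (m + 1) ^ 2 * fNormSq (homComp m u)) : MemF w := by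
  rw [memF_iff_fLNorm_ne_top hwd]
  have hp' : (1 : ℝ) ≤ p := by exact_mod_cast hp
  have h := mul_fLNorm_le_of_homExp hu hv.1.continuous huv hw hg zero_le_one fun m => by
    have := fNormSq_nonneg (homComp m u)
    rw [one_mul]
    refine (hle m).trans ?_
    gcongr
  rw [ENNReal.ofReal_one, one_mul] at h
  exact ne_top_of_le_ne_top ((memF_iff_fLNorm_ne_top hv.1).1 hv) h

theorem fNormSq_pdz_homComp_le {n : ℕ} {u : Cn n → ℂ} (hu : Differentiable ℂ u) (k : Fin n)
    (m : ℕ) : fNormSq (pdz k (homComp m u)) ≤ m * fNormSq (homComp m u) :=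
  fNormSq_pdz_le (polyGrowth_homComp hu m)
    (fun z => by simpa using sum_coord_mul_pdz_homComp hu m z) k

theorem memF_of_euler {n : ℕ} {u v : Cn n → ℂ} (hu : Differentiable ℂ u) (hv : MemF v)
    {p : ℕ} (hp : 1 ≤ p) (huv : ∀ z, ∑ j, z j * pdz j u z + p * u z = v z) : MemF u :=
  memF_of_homExp hu hv hp huv hu (homExp_homComp hu) (polyGrowth_homComp hu) fun m => by
    have := fNormSq_nonneg (homComp m u)
    have hm : (0 : ℝ) ≤ m := Nat.cast_nonneg m
    nlinarith [mul_nonneg hm this, mul_nonneg hm (mul_nonneg hm this)]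

theorem memF_pdz_of_euler {n : ℕ} {u v : Cn n → ℂ} (hu : Differentiable ℂ u) (hv : MemF v)
    {p : ℕ} (hp : 1 ≤ p) (huv : ∀ z, ∑ j, z j * pdz j u z + p * u z = v z)
    (k : Fin n) : MemF (pdz k u) :=
  memF_of_homExp hu hv hp huv (differentiable_pdz k hu) (homExp_pdz hu k)
    (fun m => (polyGrowth_homComp hu m).pdz k) fun m => by
    have := fNormSq_nonneg (homComp m u)
    have hm : (0 : ℝ) ≤ m := Nat.cast_nonneg m
    have h1 := fNormSq_pdz_homComp_le hu k m
    nlinarith [mul_nonneg hm this, mul_nonneg hm (mul_nonneg hm this)]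

theorem memF_coord_mul_of_euler {n : ℕ} {u v : Cn n → ℂ} (hu : Differentiable ℂ u) (hv : MemF v)
    {p : ℕ} (hp : 1 ≤ p) (huv : ∀ z, ∑ j, z j * pdz j u z + p * u z = v z)
    (j : Fin n) : MemF (fun z => z j * u z) :=
  memF_of_homExp hu hv hp huv (by fun_prop) ((homExp_homComp hu).coord_mul j)
    (fun m => (polyGrowth_homComp hu m).coord_mul j) fun m => by
    have := fNormSq_nonneg (homComp m u)
    have hm : (0 : ℝ) ≤ m := Nat.cast_nonneg m
    have h1 := fNormSq_coord_mul_le (polyGrowth_homComp hu m) (a := m)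
      (fun z => by simpa using sum_coord_mul_pdz_homComp hu m z) j
    nlinarith [mul_nonneg hm this, mul_nonneg hm (mul_nonneg hm this)]

theorem memF_coord_mul_pdz_of_euler {n : ℕ} {u v : Cn n → ℂ} (hu : Differentiable ℂ u) (hv : MemF v)
    {p : ℕ} (hp : 1 ≤ p) (huv : ∀ z, ∑ j, z j * pdz j u z + p * u z = v z)
    (j k : Fin n) : MemF (fun z => z j * pdz k u z) := by
  have hd := differentiable_pdz k hu
  refine memF_of_homExp hu hv hp huv (by fun_prop) ((homExp_pdz hu k).coord_mul j)
    (fun m => ((polyGrowth_homComp hu m).pdz k).coord_mul j) fun m => ?_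
  have := fNormSq_nonneg (homComp m u)
  have hm : (0 : ℝ) ≤ m := Nat.cast_nonneg m
  have h1 := fNormSq_coord_mul_le ((polyGrowth_homComp hu m).pdz k) (a := (m : ℝ) - 1)
    (fun z => by
      have := sum_coord_mul_pdz_of_homogeneous
        (differentiable_pdz k (differentiable_homComp m hu))
        (fun c z hc => (homExp_pdz hu k).hom m c z hc) z
      simpa using this) j
  have h2 := mul_le_mul_of_nonneg_left (fNormSq_pdz_homComp_le hu k m) hm
  nlinarith [mul_nonneg hm this]

theorem memF_pdz_coord_mul_of_euler {n : ℕ} {u v : Cn n → ℂ} (hu : Differentiable ℂ u) (hv : MemF v)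
    {p : ℕ} (hp : 1 ≤ p) (huv : ∀ z, ∑ j, z j * pdz j u z + p * u z = v z)
    (j k : Fin n) : MemF (pdz k (fun z => z j * u z)) := by
  rw [funext (pdz_coord_mul hu j k)]
  refine MemF.add ?_ (memF_coord_mul_pdz_of_euler hu hv hp huv j k)
  split_ifs
  · exact memF_of_euler hu hv hp huv
  · exact memF_zero

/-- The operator `E + p` has an entire right inverse. -/
def eulerInv {n : ℕ} (p : ℕ) (v : Cn n → ℂ) (z : Cn n) : ℂ :=
  ∫ t in (0 : ℝ)..1, (t : ℂ) ^ (p - 1) * v ((t : ℂ) • z)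

theorem eulerInv_zero {n : ℕ} (p : ℕ) : eulerInv p (0 : Cn n → ℂ) = 0 := by
  ext z
  simp [eulerInv]

theorem differentiable_eulerInv {n : ℕ} (p : ℕ) {v : Cn n → ℂ} (hv : Differentiable ℂ v) :
    Differentiable ℂ (eulerInv p v) := by
  have := differentiable_integral_affine hv (a := fun t => (t : ℂ)) (b := fun _ => 0)
    (c := fun t => (t : ℂ) ^ (p - 1)) (by fun_prop) (by fun_prop) (by fun_prop) 1
  simp only [add_zero, ← intervalIntegral.integral_of_le (zero_le_one (α := ℝ))] at this
  exact this

theorem euler_eulerInv {n : ℕ} {p : ℕ} (hp : 1 ≤ p) {v : Cn n → ℂ} (hv : Differentiable ℂ v)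
    (z : Cn n) : ∑ j, z j * pdz j (eulerInv p v) z + p * eulerInv p v z = v z := by
  have hc := hv.continuous
  have hF (s : ℝ) : (s : ℂ) ^ p * eulerInv p v ((s : ℂ) • z) =
      ∫ t in (0 : ℝ)..s, (t : ℂ) ^ (p - 1) * v ((t : ℂ) • z) := by
    have := intervalIntegral.smul_integral_comp_mul_right (a := 0) (b := 1)
      (fun t : ℝ => (t : ℂ) ^ (p - 1) * v ((t : ℂ) • z)) s
    rw [zero_mul, one_mul] at this
    rw [← this, eulerInv, ← intervalIntegral.integral_smul, ← intervalIntegral.integral_const_mul]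
    refine intervalIntegral.integral_congr fun t _ => ?_
    obtain ⟨q, rfl⟩ := Nat.exists_eq_add_of_le' hp
    simp only [Nat.add_sub_cancel, smul_smul, Complex.ofReal_mul, Complex.real_smul]
    ring
  have h1 : HasDerivAt (fun s : ℝ => (s : ℂ) ^ p * eulerInv p v ((s : ℂ) • z)) (v z) 1 := by
    simp_rw [hF]
    have hcont : Continuous fun t : ℝ => (t : ℂ) ^ (p - 1) * v ((t : ℂ) • z) := by fun_prop
    simpa using intervalIntegral.integral_hasDerivAt_right (hcont.intervalIntegrable 0 1)
      (hcont.stronglyMeasurableAtFilter _ _) hcont.continuousAt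
  have h2 : HasDerivAt (fun s : ℂ => s ^ p * eulerInv p v (s • z))
      (p * eulerInv p v z + fderiv ℂ (eulerInv p v) z z) ((1 : ℝ) : ℂ) := by
    have h3 := hasDerivAt_comp_line (differentiable_eulerInv p hv) 0 z 1
    simp only [zero_add, one_smul] at h3
    simpa using (hasDerivAt_pow p (1 : ℂ)).fun_mul h3
  rw [← fderiv_apply_eq_sum_pdz, add_comm]
  exact h2.comp_ofReal.unique h1

theorem eq_zero_of_euler_eq_zero {n : ℕ} {p : ℕ} (hp : 1 ≤ p) {w : Cn n → ℂ}
    (hw : Differentiable ℂ w) (h : ∀ z, ∑ j, z j * pdz j w z + p * w z = 0) : w = 0 := by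
  ext z
  have hd (s : ℂ) : HasDerivAt (fun s : ℂ => s ^ p * w (s • z)) 0 s := by
    have h3 := hasDerivAt_comp_line hw 0 z s
    simp only [zero_add] at h3
    refine ((hasDerivAt_pow p s).fun_mul h3).congr_deriv ?_
    have h4 := h (s • z)
    rw [← fderiv_apply_eq_sum_pdz, map_smul, smul_eq_mul] at h4
    obtain ⟨q, rfl⟩ := Nat.exists_eq_add_of_le' hp
    simp only [Nat.add_sub_cancel, pow_succ]
    linear_combination s ^ q * h4
  have := is_const_of_deriv_eq_zero (fun s => (hd s).differentiableAt) (fun s => (hd s).deriv) 1 0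
  simpa [Nat.one_le_iff_ne_zero.1 hp] using this

/-! ### The complex Laplacian in coordinates -/

theorem sgn_insert {n : ℕ} (i : Fin n) {a : Fin n} {K : Finset (Fin n)} (ha : a ∉ K) :
    sgn i (insert a K) = (if a < i then -1 else 1) * sgn i K := by
  unfold sgn
  rw [Finset.filter_insert]
  split_ifs with h
  · rw [Finset.card_insert_of_notMem (by simp [ha]), pow_succ']
  · rw [one_mul]

theorem sgn_mul_self {n : ℕ} (i : Fin n) (K : Finset (Fin n)) : sgn i K * sgn i K = 1 := by
  rw [sgn, ← mul_pow]
  simp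

theorem sgn_mul_sgn_insert_erase {n : ℕ} {j k : Fin n} {J : Finset (Fin n)} (hj : j ∉ J)
    (hk : k ∈ J) : sgn j J * sgn k (insert j (J.erase k)) =
      -(sgn k (J.erase k) * sgn j (J.erase k)) := by
  have hjk : j ≠ k := fun h => hj (h ▸ hk)
  have h1 := sgn_insert j (Finset.notMem_erase k J)
  rw [Finset.insert_erase hk] at h1
  rw [h1, sgn_insert k (fun h => hj (Finset.mem_of_mem_erase h))]
  rcases lt_or_gt_of_ne hjk with h | h
  · rw [if_neg h.not_gt, if_pos h]; ring
  · rw [if_pos h, if_neg h.not_gt]; ring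

theorem pdz_sum_const_mul {n : ℕ} {ι : Type*} (s : Finset ι) (c : ι → ℂ) {f : ι → Cn n → ℂ}
    (hf : ∀ i, Differentiable ℂ (f i)) (k : Fin n) (z : Cn n) :
    pdz k (fun z => ∑ i ∈ s, c i * f i z) z = ∑ i ∈ s, c i * pdz k (f i) z := by
  have h : HasFDerivAt (fun z => ∑ i ∈ s, c i * f i z) (∑ i ∈ s, c i • fderiv ℂ (f i) z) z :=
    HasFDerivAt.fun_sum fun i _ => (hf i z).hasFDerivAt.const_mul (c i)
  rw [pdz, h.fderiv]
  simp [pdz]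

theorem pdz_dStarOp {n : ℕ} {u : FormC n} (hu : ∀ J, Differentiable ℂ (u J))
    (K : Finset (Fin n)) (k : Fin n) (z : Cn n) :
    pdz k (dStarOp u K) z =
      ∑ j ∈ Kᶜ, sgn j K * ((if j = k then u (insert j K) z else 0) +
        z j * pdz k (u (insert j K)) z) := by
  unfold dStarOp
  rw [pdz_sum_const_mul _ _ (fun j => by have := hu (insert j K); fun_prop)]
  exact Finset.sum_congr rfl fun j _ => by rw [pdz_coord_mul (hu _)]

theorem dStarOp_dOp_apply {n : ℕ} (u : FormC n) (J : Finset (Fin n)) (z : Cn n) :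
    dStarOp (dOp u) J z = ∑ j ∈ Jᶜ, z j * pdz j (u J) z -
      ∑ k ∈ J, ∑ j ∈ Jᶜ, sgn k (J.erase k) * sgn j (J.erase k) *
        (z j * pdz k (u (insert j (J.erase k))) z) := by
  rw [Finset.sum_comm, ← Finset.sum_sub_distrib]
  refine Finset.sum_congr rfl fun j hj => ?_
  have hj' : j ∉ J := Finset.mem_compl.1 hj
  simp only [dOp]
  rw [Finset.sum_insert hj', Finset.erase_insert hj', mul_add, mul_add, sub_eq_add_neg,
    ← Finset.sum_neg_distrib, Finset.mul_sum, Finset.mul_sum]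
  congr 1
  · linear_combination (z j * pdz j (u J) z) * sgn_mul_self j J
  · refine Finset.sum_congr rfl fun k hk => ?_
    rw [Finset.erase_insert_of_ne (ne_of_mem_of_not_mem hk hj').symm]
    linear_combination (z j * pdz k (u (insert j (J.erase k))) z) *
      sgn_mul_sgn_insert_erase hj' hk

theorem dOp_dStarOp_apply {n : ℕ} {u : FormC n} (hu : ∀ J, Differentiable ℂ (u J))
    (J : Finset (Fin n)) (z : Cn n) :
    dOp (dStarOp u) J z = ∑ k ∈ J, (u J z + z k * pdz k (u J) z) +
      ∑ k ∈ J, ∑ j ∈ Jᶜ, sgn k (J.erase k) * sgn j (J.erase k) *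
        (z j * pdz k (u (insert j (J.erase k))) z) := by
  rw [← Finset.sum_add_distrib]
  refine Finset.sum_congr rfl fun k hk => ?_
  rw [pdz_dStarOp hu, Finset.compl_erase, Finset.sum_insert (by simpa using hk), if_pos rfl,
    Finset.insert_erase hk, mul_add, Finset.mul_sum]
  congr 1
  · linear_combination (u J z + z k * pdz k (u J) z) * sgn_mul_self k (J.erase k)
  · refine Finset.sum_congr rfl fun j hj => ?_
    rw [if_neg (ne_of_mem_of_not_mem hk (Finset.mem_compl.1 hj)).symm]
    ring

/-- The complex Laplacian acts on coefficients of degree `p` as `E + p`. -/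
theorem boxOp_apply {n : ℕ} {u : FormC n} (hu : ∀ J, Differentiable ℂ (u J))
    (J : Finset (Fin n)) (z : Cn n) :
    boxOp u J z = ∑ j, z j * pdz j (u J) z + J.card * u J z := by
  rw [boxOp, dStarOp_dOp_apply, dOp_dStarOp_apply hu, Finset.sum_add_distrib, Finset.sum_const,
    nsmul_eq_mul, ← Finset.sum_add_sum_compl J]
  ring

theorem boxOp_eq_iff {n p : ℕ} {u v : FormC n} (hu : ∀ J, Differentiable ℂ (u J))
    (hup : IsDeg p u) (hvp : IsDeg p v) :
    boxOp u = v ↔ ∀ J z, ∑ j, z j * pdz j (u J) z + p * u J z = v J z := by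
  refine ⟨fun h J z => ?_, fun h => funext₂ fun J z => ?_⟩
  all_goals by_cases hJ : J.card = p
  · rw [← h, boxOp_apply hu, hJ]
  · simp [hup J hJ, hvp J hJ, pdz]
  · rw [boxOp_apply hu, hJ, h]
  · simp [boxOp_apply hu, hup J hJ, hvp J hJ, pdz]

theorem domBox_of_euler {n p : ℕ} (hp : 1 ≤ p) {u v : FormC n}
    (hu : ∀ J, Differentiable ℂ (u J)) (hv : MemA2 v)
    (huv : ∀ J z, ∑ j, z j * pdz j (u J) z + p * u J z = v J z) : domBox u := by
  have h0 : MemA2 u := fun J => memF_of_euler (hu J) (hv J) hp (huv J)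
  have h1 : MemA2 (dOp u) := fun J => MemF.sum fun j _ =>
    (memF_pdz_of_euler (hu _) (hv _) hp (huv _) j).const_mul _
  have h2 : MemA2 (dStarOp u) := fun J => MemF.sum fun j _ =>
    (memF_coord_mul_of_euler (hu _) (hv _) hp (huv _) j).const_mul _
  have h3 : MemA2 (dStarOp (dOp u)) := fun J => MemF.sum fun j _ => by
    refine MemF.const_mul ?_ _
    simp only [dOp, Finset.mul_sum, mul_left_comm (_ : ℂ) (sgn _ _)]
    exact MemF.sum fun k _ =>
      (memF_coord_mul_pdz_of_euler (hu _) (hv _) hp (huv _) j k).const_mul _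
  have h4 : MemA2 (dOp (dStarOp u)) := fun J => MemF.sum fun k _ => by
    refine MemF.const_mul ?_ _
    rw [funext (pdz_dStarOp hu (J.erase k) k)]
    refine MemF.sum fun j _ => MemF.const_mul ?_ _
    rw [← funext (pdz_coord_mul (hu (insert j (J.erase k))) j k)]
    exact memF_pdz_coord_mul_of_euler (hu _) (hv _) hp (huv _) j k
  exact ⟨⟨h0, h1⟩, ⟨h0, h2⟩, ⟨h1, h3⟩, ⟨h2, h4⟩⟩

theorem differentiable_of_domBox {n : ℕ} {u : FormC n} (hu : domBox u) (J : Finset (Fin n)) :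
    Differentiable ℂ (u J) :=
  (hu.1.1 J).1

theorem eq_of_euler_eq {n : ℕ} {p : ℕ} (hp : 1 ≤ p) {u w v : Cn n → ℂ}
    (hu : Differentiable ℂ u) (hw : Differentiable ℂ w)
    (huv : ∀ z, ∑ j, z j * pdz j u z + p * u z = v z)
    (hwv : ∀ z, ∑ j, z j * pdz j w z + p * w z = v z) : u = w := by
  refine sub_eq_zero.1 (eq_zero_of_euler_eq_zero hp (hu.sub hw) fun z => ?_)
  have h (j : Fin n) : pdz j (u - w) z = pdz j u z - pdz j w z := by
    simp [pdz, fderiv_sub (hu z) (hw z)]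
  simp only [h, mul_sub, Finset.sum_sub_distrib, Pi.sub_apply]
  linear_combination huv z - hwv z

/-- For `1 ≤ p ≤ n−1` the operator `□̃_p = ∂*∂ + ∂∂*` is a bijection from its
domain onto `A²_{(p,0)}(ℂⁿ, e^{-|z|²})`, with bounded inverse `Ñ_p` satisfying
`‖Ñ_p u‖ ≤ (1/p)‖u‖`. -/
theorem stmt12 {n p : ℕ} (hp : 1 ≤ p) (hpn : p ≤ n - 1) :
    -- bijectivity of □̃_p : dom □̃_p → A²_{(p,0)}
    (∀ v : FormC n, IsDeg p v → MemA2 v →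
      ∃! u : FormC n, IsDeg p u ∧ domBox u ∧ boxOp u = v) ∧
    -- boundedness of the inverse: ‖Ñ_p v‖ ≤ (1/p) ‖v‖
    (∀ v : FormC n, IsDeg p v → MemA2 v →
      ∀ u : FormC n, IsDeg p u → domBox u → boxOp u = v →
        Real.sqrt (formNormSq u) ≤ (1 / p) * Real.sqrt (formNormSq v)) := by
  refine ⟨fun v hvp hv => ?_, fun v hvp hv u hup hu huv => ?_⟩
  · have hd (J : Finset (Fin n)) : Differentiable ℂ (eulerInv p (v J)) :=
      differentiable_eulerInv p (hv J).1
    have he (J : Finset (Fin n)) := euler_eulerInv hp (hv J).1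
    have hdeg : IsDeg p fun J => eulerInv p (v J) := fun J hJ => by
      simp only [hvp J hJ, eulerInv_zero]
    refine ⟨fun J => eulerInv p (v J), ⟨hdeg, domBox_of_euler hp hd hv he,
      (boxOp_eq_iff hd hdeg hvp).2 he⟩, fun w ⟨hwp, hw, hwv⟩ => funext fun J => ?_⟩
    have hwd := differentiable_of_domBox hw
    exact eq_of_euler_eq hp (hwd J) (hd J) ((boxOp_eq_iff hwd hwp hvp).1 hwv J) (he J)
  · have hd := differentiable_of_domBox hu
    have he := (boxOp_eq_iff hd hup hvp).1 huv
    have h1 : formNormSq u ≤ (1 / p) ^ 2 * formNormSq v := by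
      rw [formNormSq, formNormSq, Finset.mul_sum]
      exact Finset.sum_le_sum fun J _ => fNormSq_le_of_euler (hd J) (hv J) hp (he J)
    calc Real.sqrt (formNormSq u) ≤ Real.sqrt ((1 / p) ^ 2 * formNormSq v) := Real.sqrt_le_sqrt h1
      _ = _ := by rw [Real.sqrt_mul (by positivity), Real.sqrt_sq (by positivity)]
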